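/- For every n ≥ 1 there exists a Hamiltonian H on (ℂ³)^{⊗n} that is a finite sum of positive semidefinite Hermitian terms, each of operator norm at most 1 and each acting nontrivially only on a set of at most 3 consecutive qutrits (3-local on a line), such that H is positive semidefinite and its kernel is exactly the one-dimensional span of the history cat state Ψ_n; in particular, Ψ_n is (up to scalar) the unique ground state of H, with ground energy 0. -/

import Mathlib

open scoped Classical ComplexOrder
open Matrix

noncomputable section
namespace CatState

/-- The pattern `b^{⊗t} ⊗ |2⟩^{⊗(n-t)}` on `n` qutrits (`0`-based sites). -/
def catPat (n t : ℕ) (b : Fin 3) : Fin n → Fin 3 := fun i => if (i : ℕ) < t then b else 2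

/-- The vector `ψ_t`: `ψ_0 = |2⟩^{⊗n}`, and for `t ≥ 1`,
`ψ_t = |Cat_t⟩ ⊗ |2⟩^{⊗(n-t)}` where `|Cat_t⟩ = (|0⟩^{⊗t} + |1⟩^{⊗t})/√2`. -/
def psi (n t : ℕ) : (Fin n → Fin 3) → ℂ :=
  if t = 0 then fun x => if x = catPat n 0 0 then 1 else 0
  else fun x => (Real.sqrt 2 : ℂ)⁻¹ *
    ((if x = catPat n t 0 then 1 else 0) + (if x = catPat n t 1 then 1 else 0))

/-- The history cat state `Ψ_n = (1/√(n+1)) Σ_{t=0}^{n} ψ_t`. -/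
def histCat (n : ℕ) : (Fin n → Fin 3) → ℂ :=
  fun x => (Real.sqrt (n + 1) : ℂ)⁻¹ * ∑ t ∈ Finset.range (n + 1), psi n t x

/-- The single-site operator acting as the projector onto the span of `{|a⟩ : a ∈ s}`
on qutrit `i` and as the identity elsewhere. -/
def siteProj (n : ℕ) (i : Fin n) (s : Finset (Fin 3)) :
    Matrix (Fin n → Fin 3) (Fin n → Fin 3) ℂ :=
  Matrix.diagonal (fun x => if x i ∈ s then 1 else 0)

/-- `A_i = |0⟩⟨0| + |2⟩⟨2|` on qutrit `i`, identity elsewhere. -/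
def opA (n : ℕ) (i : Fin n) : Matrix (Fin n → Fin 3) (Fin n → Fin 3) ℂ :=
  siteProj n i {0, 2}

/-- `B_i = |1⟩⟨1| + |2⟩⟨2|` on qutrit `i`, identity elsewhere. -/
def opB (n : ℕ) (i : Fin n) : Matrix (Fin n → Fin 3) (Fin n → Fin 3) ℂ :=
  siteProj n i {1, 2}

/-- `P_i^{(1)} = |1⟩⟨1|` on qutrit `i`, identity elsewhere. -/
def opP1 (n : ℕ) (i : Fin n) : Matrix (Fin n → Fin 3) (Fin n → Fin 3) ℂ :=
  siteProj n i {1}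


/-- `M` acts nontrivially only on the qudits in `S` (it is `N ⊗ I` for some matrix `N`
on the sites in `S`). -/
def ActsOn {ι : Type} [Fintype ι] [DecidableEq ι] (q : ℕ)
    (M : Matrix (ι → Fin q) (ι → Fin q) ℂ) (S : Finset ι) : Prop :=
  ∃ N : Matrix ({i : ι // i ∈ S} → Fin q) ({i : ι // i ∈ S} → Fin q) ℂ,
    ∀ x y : ι → Fin q,
      M x y =
        if ∀ i ∉ S, x i = y i then N (fun i => x i.1) (fun i => y i.1) else 0

section generic
variable {ι : Type} [Fintype ι] [DecidableEq ι]

/-- local vector -/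
def gvec (S : Finset ι) (p q : ι → Fin 3) (c : ℝ) (x : {i : ι // i ∈ S} → Fin 3) : ℂ :=
  (if x = (fun i => p i.1) then 1 else 0) - (c : ℂ) * (if x = (fun i => q i.1) then 1 else 0)

/-- isometry-like factor -/
def Wm (S : Finset ι) (p q : ι → Fin 3) (c : ℝ) :
    Matrix (ι → Fin 3) ({i : ι // i ∉ S} → Fin 3) ℂ :=
  fun x e => if (fun i : {i : ι // i ∉ S} => x i.1) = e then gvec S p q c (fun i => x i.1) else 0

lemma W_mul (S : Finset ι) (p q : ι → Fin 3) (c : ℝ) (x y : ι → Fin 3) :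
    (Wm S p q c * (Wm S p q c)ᴴ) x y = if ∀ i ∉ S, x i = y i then
      gvec S p q c (fun i => x i.1) * star (gvec S p q c (fun i => y i.1)) else 0 := by
  rw [Matrix.mul_apply]
  simp only [Matrix.conjTranspose_apply, Wm]
  rw [Finset.sum_eq_single (fun i : {i : ι // i ∉ S} => x i.1)]
  · have : ((fun i : {i : ι // i ∉ S} => y i.1) = (fun i : {i : ι // i ∉ S} => x i.1)) ↔
        ∀ i ∉ S, x i = y i := by
      constructor
      · intro h i hi
        exact (congrFun h ⟨i, hi⟩).symm
      · intro h
        funext i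
        exact (h i.1 i.2).symm
    by_cases h : ∀ i ∉ S, x i = y i
    · rw [if_pos rfl, if_pos (this.2 h), if_pos h]
    · rw [if_neg (fun h' => h (this.1 h')), if_neg h]; simp
  · intro e _ he
    rw [if_neg (fun h => he h.symm)]; simp
  · simp

/-- constraint -/
def Con (S : Finset ι) (p q : ι → Fin 3) (c : ℝ) (v : (ι → Fin 3) → ℂ) : Prop :=
  ∀ x y : ι → Fin 3, (∀ i ∉ S, x i = y i) → (∀ i ∈ S, x i = p i) → (∀ i ∈ S, y i = q i) →
    v x = c * v y

lemma Wv (S : Finset ι) (p q : ι → Fin 3) (c : ℝ) (v : (ι → Fin 3) → ℂ)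
    (x0 y0 : ι → Fin 3) (h : ∀ i ∉ S, x0 i = y0 i) (hx : ∀ i ∈ S, x0 i = p i)
    (hy : ∀ i ∈ S, y0 i = q i) :
    ((Wm S p q c)ᴴ *ᵥ v) (fun i => x0 i.1) = v x0 - c * v y0 := by
  have key : ∀ x, star (Wm S p q c x (fun i => x0 i.1)) * v x =
      (if x = x0 then v x else 0) - c * (if x = y0 then v x else 0) := by
    intro x
    have e1 : x = x0 ↔ ((fun i : {i : ι // i ∉ S} => x i.1) = fun i => x0 i.1) ∧
        ((fun i : {i : ι // i ∈ S} => x i.1) = fun i => p i.1) := by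
      constructor
      · rintro rfl
        exact ⟨rfl, funext fun i => hx i.1 i.2⟩
      · rintro ⟨h1, h2⟩
        funext i
        by_cases hi : i ∈ S
        · rw [hx i hi]; exact congrFun h2 ⟨i, hi⟩
        · exact congrFun h1 ⟨i, hi⟩
    have e2 : x = y0 ↔ ((fun i : {i : ι // i ∉ S} => x i.1) = fun i => x0 i.1) ∧
        ((fun i : {i : ι // i ∈ S} => x i.1) = fun i => q i.1) := by
      constructor
      · rintro rfl
        exact ⟨funext fun i => (h i.1 i.2).symm, funext fun i => hy i.1 i.2⟩
      · rintro ⟨h1, h2⟩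
        funext i
        by_cases hi : i ∈ S
        · rw [hy i hi]; exact congrFun h2 ⟨i, hi⟩
        · rw [← h i hi]; exact congrFun h1 ⟨i, hi⟩
    simp only [e1, e2, Wm, gvec]
    by_cases h1 : ((fun i : {i : ι // i ∉ S} => x i.1) = fun i => x0 i.1)
    · simp only [h1, true_and, if_true]
      split_ifs <;> simp [sub_mul]
    · simp [h1]
  simp only [Matrix.mulVec, dotProduct, Matrix.conjTranspose_apply, key, Finset.sum_sub_distrib,
    ← Finset.mul_sum]
  simp

lemma ker_iff (S : Finset ι) (p q : ι → Fin 3) (c : ℝ) (v : (ι → Fin 3) → ℂ) :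
    (Wm S p q c * (Wm S p q c)ᴴ) *ᵥ v = 0 ↔ Con S p q c v := by
  rw [Matrix.self_mul_conjTranspose_mulVec_eq_zero]
  constructor
  · intro h x y h1 h2 h3
    have := Wv S p q c v x y h1 h2 h3
    rw [h] at this
    exact (sub_eq_zero.1 this.symm)
  · intro h
    funext e
    let x0 : ι → Fin 3 := fun i => if hi : i ∈ S then p i else e ⟨i, hi⟩
    let y0 : ι → Fin 3 := fun i => if hi : i ∈ S then q i else e ⟨i, hi⟩
    have h1 : ∀ i ∉ S, x0 i = y0 i := by intro i hi; simp [x0, y0, hi]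
    have h2 : ∀ i ∈ S, x0 i = p i := by intro i hi; simp [x0, hi]
    have h3 : ∀ i ∈ S, y0 i = q i := by intro i hi; simp [y0, hi]
    have he : e = fun i => x0 i.1 := by
      funext i
      simp [x0, i.2]
    rw [he, Wv S p q c v x0 y0 h1 h2 h3, h x0 y0 h1 h2 h3]
    simp

end generic

section scale
open scoped MatrixOrder Matrix.Norms.L2Operator

lemma exists_scale {m : Type} [Fintype m] [DecidableEq m] (T : Matrix m m ℂ)
    (hT : T.PosSemidef) : ∃ r : ℝ, 0 < r ∧ (1 - (r : ℂ) • T).PosSemidef := by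
  have h1 : T ≤ algebraMap ℝ _ ‖T‖ := IsSelfAdjoint.le_algebraMap_norm_self (a := T) hT.1
  rw [Matrix.le_iff] at h1
  have h2 := h1.add (Matrix.PosSemidef.one (n := m) (R := ℂ))
  have hr : (0:ℝ) < ‖T‖ + 1 := by positivity
  refine ⟨(‖T‖ + 1)⁻¹, by positivity, ?_⟩
  have h3 := h2.smul (a := (((‖T‖ + 1)⁻¹ : ℝ) : ℂ)) (by
    exact_mod_cast (inv_pos.2 hr).le)
  have e : (1 - (((‖T‖ + 1)⁻¹ : ℝ) : ℂ) • T) =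
      (((‖T‖ + 1)⁻¹ : ℝ) : ℂ) • (algebraMap ℝ (Matrix m m ℂ) ‖T‖ - T + 1) := by
    rw [Algebra.algebraMap_eq_smul_one]
    have : ((‖T‖ : ℂ) + 1) ≠ 0 := by exact_mod_cast hr.ne'
    ext i j
    simp [Matrix.one_apply]
    split_ifs <;> (try simp) <;> field_simp <;> ring
  rw [e]
  exact h3

end scale

lemma sum_psd {m : Type} [Fintype m] [DecidableEq m] (l : List (Matrix m m ℂ))
    (h : ∀ T ∈ l, T.PosSemidef) : l.sum.PosSemidef := by
  induction l with
  | nil => simpa using Matrix.PosSemidef.zero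
  | cons a l ih =>
    rw [List.sum_cons]
    exact (h a (by simp)).add (ih fun T hT => h T (by simp [hT]))

lemma sum_ker {m : Type} [Fintype m] [DecidableEq m] (l : List (Matrix m m ℂ))
    (h : ∀ T ∈ l, T.PosSemidef) (v : m → ℂ) : l.sum *ᵥ v = 0 ↔ ∀ T ∈ l, T *ᵥ v = 0 := by
  induction l with
  | nil => simp
  | cons a l ih =>
    have ha := h a (by simp)
    have hl' : ∀ T ∈ l, T.PosSemidef := fun T hT => h T (by simp [hT])
    have hl := sum_psd l hl'
    rw [List.sum_cons, List.forall_mem_cons, ← ih hl', Matrix.add_mulVec]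
    constructor
    · intro h0
      rw [← ha.dotProduct_mulVec_zero_iff, ← hl.dotProduct_mulVec_zero_iff]
      have h1 := ha.dotProduct_mulVec_nonneg v
      have h2 := hl.dotProduct_mulVec_nonneg v
      have h3 : star v ⬝ᵥ (a *ᵥ v) + star v ⬝ᵥ (l.sum *ᵥ v) = 0 := by
        rw [← dotProduct_add, h0, dotProduct_zero]
      exact (add_eq_zero_iff_of_nonneg h1 h2).1 h3
    · rintro ⟨h1, h2⟩
      rw [h1, h2, add_zero]

/-- legal configurations -/
def Legal (n : ℕ) (x : Fin n → Fin 3) : Prop :=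
  ∃ t ≤ n, ∃ b : Fin 3, b ≠ 2 ∧ x = catPat n t b

lemma fin3 (b : Fin 3) (h : b ≠ 2) : b = 0 ∨ b = 1 := by
  revert h; revert b; decide

lemma catPat_zero (n : ℕ) (b b' : Fin 3) : catPat n 0 b = catPat n 0 b' := by
  funext i; simp [catPat]

lemma catPat_inj (n t t' : ℕ) (b b' : Fin 3) (ht : t ≤ n) (ht' : t' ≤ n) (hb : b ≠ 2)
    (hb' : b' ≠ 2) (h : catPat n t b = catPat n t' b') : t = t' ∧ (t ≠ 0 → b = b') := by
  have key : ∀ i, i < n → (if i < t then b else 2) = (if i < t' then b' else 2) :=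
    fun i hi => congrFun h ⟨i, hi⟩
  have h1 : t = t' := by
    rcases lt_trichotomy t t' with h1 | h1 | h1
    · have := key t (by omega)
      simp [h1] at this
      exact absurd this.symm hb'
    · exact h1
    · have := key t' (by omega)
      simp [h1] at this
      exact absurd this hb
  subst h1
  refine ⟨rfl, fun h0 => ?_⟩
  have := key 0 (by omega)
  simpa [Nat.pos_of_ne_zero h0] using this

lemma hist_illegal (n : ℕ) (x : Fin n → Fin 3) (hx : ¬ Legal n x) : histCat n x = 0 := by
  unfold histCat
  rw [Finset.sum_eq_zero, mul_zero]
  intro t ht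
  have ht : t ≤ n := by simpa [Nat.lt_succ_iff] using ht
  have h0 : x ≠ catPat n t 0 := fun h => hx ⟨t, ht, 0, by decide, h⟩
  have h1 : x ≠ catPat n t 1 := fun h => hx ⟨t, ht, 1, by decide, h⟩
  unfold psi
  split_ifs with h
  · subst h; simp [h0]
  · simp [h0, h1]

lemma hist_legal (n t : ℕ) (b : Fin 3) (ht : t ≤ n) (hb : b ≠ 2) :
    histCat n (catPat n t b) = (Real.sqrt (n + 1) : ℂ)⁻¹ *
      (if t = 0 then 1 else (Real.sqrt 2 : ℂ)⁻¹) := by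
  unfold histCat
  congr 1
  rw [Finset.sum_eq_single t]
  · by_cases h : t = 0
    · subst h
      simp [psi, catPat_zero n b 0]
    · simp only [psi, h, if_false]
      rcases fin3 b hb with rfl | rfl
      · have : catPat n t 0 ≠ catPat n t 1 := fun h' =>
          absurd ((catPat_inj n t t 0 1 ht ht (by decide) (by decide) h').2 h) (by decide)
        simp [this]
      · have : catPat n t 1 ≠ catPat n t 0 := fun h' =>
          absurd ((catPat_inj n t t 1 0 ht ht (by decide) (by decide) h').2 h) (by decide)
        simp [this]
  · intro s hs hst
    have hs : s ≤ n := by simpa [Nat.lt_succ_iff] using hs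
    have h0 : catPat n t b ≠ catPat n s 0 := fun h =>
      hst (catPat_inj n t s b 0 ht hs hb (by decide) h).1.symm
    have h1 : catPat n t b ≠ catPat n s 1 := fun h =>
      hst (catPat_inj n t s b 1 ht hs hb (by decide) h).1.symm
    unfold psi
    split_ifs with h
    · subst h; simp [h0]
    · simp [h0, h1]
  · intro h
    exact absurd (Finset.mem_range.2 (Nat.lt_succ_of_le ht)) h

/-- forbidden neighbours -/
def Bad (a b : Fin 3) : Prop := b ≠ a ∧ b ≠ 2

lemma legal_of_good (n : ℕ) (x : Fin n → Fin 3)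
    (h : ∀ i, ∀ hi : i + 1 < n, ¬ Bad (x ⟨i, by omega⟩) (x ⟨i + 1, hi⟩)) : Legal n x := by
  have key : ∀ m, m ≤ n → ∃ t ≤ m, ∃ b : Fin 3, b ≠ 2 ∧
      ∀ i, ∀ hi : i < n, i < m → x ⟨i, hi⟩ = if i < t then b else 2 := by
    intro m
    induction m with
    | zero => intro _; exact ⟨0, le_rfl, 0, by decide, by intro i _ hi; omega⟩
    | succ m ih =>
      intro hm
      obtain ⟨t, ht, b, hb, hx⟩ := ih (by omega)
      by_cases h2 : x ⟨m, by omega⟩ = 2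
      · refine ⟨t, by omega, b, hb, fun i hi him => ?_⟩
        rcases Nat.lt_succ_iff_lt_or_eq.1 him with h' | rfl
        · exact hx i hi h'
        · rw [if_neg (by omega), h2]
      · refine ⟨m + 1, le_rfl, x ⟨m, by omega⟩, h2, fun i hi him => ?_⟩
        rw [if_pos him]
        rcases Nat.eq_zero_or_pos m with rfl | hpos
        · congr 2; omega
        · obtain ⟨k, rfl⟩ : ∃ k, m = k + 1 := ⟨m - 1, by omega⟩
          have hk := h k (by omega)
          have hk' : x ⟨k + 1, by omega⟩ = x ⟨k, by omega⟩ := by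
            by_contra hne
            exact hk ⟨hne, h2⟩
          have hxk := hx k (by omega) (by omega)
          have htk : k < t := by
            by_contra hlt
            rw [if_neg hlt] at hxk
            exact h2 (hk'.trans hxk)
          rw [if_pos htk] at hxk
          rcases Nat.lt_succ_iff_lt_or_eq.1 him with h' | rfl
          · rw [hx i hi h', if_pos (by omega), hk', hxk]
          · rfl
  obtain ⟨t, ht, b, hb, hx⟩ := key n le_rfl
  exact ⟨t, ht, b, hb, funext fun i => hx i.1 i.2 i.2⟩

lemma legal_not_bad (n : ℕ) (x : Fin n → Fin 3) (hx : Legal n x) (i : ℕ) (hi : i + 1 < n) :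
    ¬ Bad (x ⟨i, by omega⟩) (x ⟨i + 1, hi⟩) := by
  obtain ⟨t, ht, b, hb, rfl⟩ := hx
  rintro ⟨h1, h2⟩
  simp only [catPat] at h1 h2
  split_ifs at h1 h2 <;> omega

/-- window -/
def win (n a : ℕ) : Finset (Fin n) :=
  Finset.univ.filter fun i : Fin n => a ≤ (i : ℕ) ∧ (i : ℕ) < a + 3

/-- coefficients -/
def cc (k : Fin 3) : ℝ := if k = 0 then 0 else if k = 1 then 1 else Real.sqrt 2

lemma con_bad (n i : ℕ) (hi : i + 1 < n) (x : Fin n → Fin 3)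
    (hb : Bad (x ⟨i, by omega⟩) (x ⟨i + 1, hi⟩)) : Con (win n i) x x (cc 0) (histCat n) := by
  intro y z _ h2 _
  have : ¬ Legal n y := by
    intro hl
    apply legal_not_bad n y hl i hi
    rw [h2 _ (by simp [win]), h2 _ (by simp [win])]
    exact hb
  rw [hist_illegal n y this]
  simp [cc]

lemma con_hop (n i : ℕ) (hi : i < n) (b : Fin 3) (hb : b ≠ 2) :
    Con (win n (i - 1)) (catPat n i b) (catPat n (i + 1) b) (cc (if i = 0 then 2 else 1))
      (histCat n) := by
  intro x y hxy hx hy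
  have lx : Legal n x → x = catPat n i b := by
    rintro ⟨t, ht, b', hb', rfl⟩
    have h1 := hx ⟨i, hi⟩ (by simp [win]; omega)
    have h1' : t ≤ i := by
      by_contra hlt
      simp [catPat, not_le.1 hlt] at h1
      exact hb' h1
    rcases Nat.eq_zero_or_pos i with rfl | hpos
    · obtain rfl : t = 0 := by omega
      exact catPat_zero n b' b
    · have h2 := hx ⟨i - 1, by omega⟩ (by simp [win]; omega)
      simp only [catPat] at h2
      rw [if_pos (show i - 1 < i by omega)] at h2
      split_ifs at h2 with h3
      · obtain rfl : t = i := by omega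
        rw [h2]
      · exact absurd h2.symm hb
  have ly : Legal n y → y = catPat n (i + 1) b := by
    rintro ⟨t, ht, b', hb', rfl⟩
    have h1 := hy ⟨i, hi⟩ (by simp [win]; omega)
    simp only [catPat] at h1
    rw [if_pos (show i < i + 1 by omega)] at h1
    split_ifs at h1 with h3
    · have h4 : t = i + 1 := by
        by_contra hne
        have h2 := hy ⟨i + 1, by omega⟩ (by simp [win]; omega)
        simp only [catPat] at h2
        rw [if_pos (by omega), if_neg (by omega)] at h2
        exact hb' h2
      rw [h4, h1]
    · exact absurd h1.symm hb
  have off : ∀ j ∉ win n (i - 1), catPat n i b j = catPat n (i + 1) b j := by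
    intro j hj
    have : (j : ℕ) ≠ i := by
      intro h
      apply hj
      simp [win]; omega
    simp only [catPat]
    split_ifs <;> first | rfl | omega
  have e : x = catPat n i b ↔ y = catPat n (i + 1) b := by
    constructor
    · intro h
      funext j
      by_cases hj : j ∈ win n (i - 1)
      · exact hy j hj
      · rw [← hxy j hj, h, off j hj]
    · intro h
      funext j
      by_cases hj : j ∈ win n (i - 1)
      · exact hx j hj
      · rw [hxy j hj, h, off j hj]
  by_cases h : x = catPat n i b
  · rw [h, e.1 h, hist_legal n i b hi.le hb, hist_legal n (i + 1) b hi hb]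
    have : (Real.sqrt 2 : ℂ) ≠ 0 := by
      exact_mod_cast (Real.sqrt_pos.2 two_pos).ne'
    by_cases h0 : i = 0
    · simp [h0, cc]
      field_simp
    · simp [h0, cc]
  · rw [hist_illegal n x (fun hl => h (lx hl)), hist_illegal n y (fun hl => h (e.2 (ly hl)))]
    simp

lemma uniq (n : ℕ) (v : (Fin n → Fin 3) → ℂ)
    (hv : ∀ a < n, ∀ p q k, Con (win n a) p q (cc k) (histCat n) → Con (win n a) p q (cc k) v) :
    ∃ c : ℂ, v = c • histCat n := by
  have h00 : histCat n (catPat n 0 0) ≠ 0 := by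
    rw [hist_legal n 0 0 (by omega) (by decide)]
    have : (Real.sqrt (n + 1) : ℂ) ≠ 0 := by
      exact_mod_cast (Real.sqrt_pos.2 (by positivity : (0:ℝ) < n + 1)).ne'
    simpa using this
  refine ⟨v (catPat n 0 0) / histCat n (catPat n 0 0), ?_⟩
  set c := v (catPat n 0 0) / histCat n (catPat n 0 0) with hc
  have leg : ∀ t, t ≤ n → ∀ b : Fin 3, b ≠ 2 → v (catPat n t b) = c * histCat n (catPat n t b) := by
    intro t
    induction t with
    | zero =>
      intro _ b hb
      rw [catPat_zero n b 0, hc, div_mul_cancel₀ _ h00]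
    | succ t ih =>
      intro ht b hb
      have h1 := con_hop n t ht b hb
      have h2 := hv (t - 1) (by omega) _ _ _ h1
      have off : ∀ j ∉ win n (t - 1), catPat n t b j = catPat n (t + 1) b j := by
        intro j hj
        have : (j : ℕ) ≠ t := by
          intro h
          apply hj
          simp [win]; omega
        simp only [catPat]
        split_ifs <;> first | rfl | omega
      have e1 := h1 _ _ off (fun _ _ => rfl) (fun _ _ => rfl)
      have e2 := h2 _ _ off (fun _ _ => rfl) (fun _ _ => rfl)
      rw [ih (by omega) b hb, e1] at e2
      have hne : ((cc (if t = 0 then 2 else 1) : ℝ) : ℂ) ≠ 0 := by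
        have : (Real.sqrt 2) ≠ 0 := (Real.sqrt_pos.2 two_pos).ne'
        split_ifs <;> simp [cc]
      apply mul_left_cancel₀ hne
      rw [← e2]; ring
  funext x
  by_cases hx : Legal n x
  · obtain ⟨t, ht, b, hb, rfl⟩ := hx
    simpa using leg t ht b hb
  · have : ∃ i, ∃ hi : i + 1 < n, Bad (x ⟨i, by omega⟩) (x ⟨i + 1, hi⟩) := by
      by_contra hcon
      push Not at hcon
      exact hx (legal_of_good n x hcon)
    obtain ⟨i, hi, hbad⟩ := this
    have := hv i (by omega) _ _ _ (con_bad n i hi x hbad) x x (fun _ _ => rfl) (fun _ _ => rfl)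
      (fun _ _ => rfl)
    rw [this, Pi.smul_apply, hist_illegal n x hx]
    simp [cc]

lemma con_smul {n : ℕ} {S : Finset (Fin n)} {p q : Fin n → Fin 3} {c : ℝ}
    {v : (Fin n → Fin 3) → ℂ} (h : Con S p q c v) (d : ℂ) : Con S p q c (d • v) := by
  intro x y h1 h2 h3
  simp only [Pi.smul_apply, smul_eq_mul]
  rw [h x y h1 h2 h3]; ring

lemma exists_term (n a : ℕ) (p q : Fin n → Fin 3) (c : ℝ) :
    ∃ T : Matrix (Fin n → Fin 3) (Fin n → Fin 3) ℂ,
      T.PosSemidef ∧ (1 - T).PosSemidef ∧ ActsOn 3 T (win n a) ∧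
      ∀ v, T *ᵥ v = 0 ↔ Con (win n a) p q c v := by
  have hP := Matrix.posSemidef_self_mul_conjTranspose (Wm (win n a) p q c)
  obtain ⟨r, hr, h1⟩ := exists_scale _ hP
  refine ⟨_, hP.smul (a := (r : ℂ)) (by exact_mod_cast hr.le), h1, ?_, ?_⟩
  · refine ⟨fun x y => r * (gvec (win n a) p q c x * star (gvec (win n a) p q c y)), ?_⟩
    intro x y
    rw [Matrix.smul_apply, W_mul, smul_eq_mul, mul_ite, mul_zero]
  · intro v
    rw [← ker_iff, Matrix.smul_mulVec, smul_eq_zero]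
    simp [hr.ne']

/-- for every `n ≥ 1` there is a Hamiltonian on `n` qutrits, given as a finite
sum of positive semidefinite Hermitian terms of operator norm at most `1` (for a PSD matrix
`T`, `‖T‖ ≤ 1` iff `1 - T` is PSD), each acting nontrivially only on at most `3` consecutive
qutrits, such that the total Hamiltonian is positive semidefinite and its kernel is exactly
the span of the history cat state `Ψ_n`. -/
theorem cat_hamiltonian_exists (n : ℕ) (hn : 1 ≤ n) :
    ∃ terms : List (Matrix (Fin n → Fin 3) (Fin n → Fin 3) ℂ),
      (∀ T ∈ terms,
        T.PosSemidef ∧ (1 - T).PosSemidef ∧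
        ∃ a : ℕ, ActsOn 3 T
          (Finset.univ.filter fun i : Fin n => a ≤ (i : ℕ) ∧ (i : ℕ) < a + 3)) ∧
      (terms.sum).PosSemidef ∧
      (∀ v : (Fin n → Fin 3) → ℂ,
        (terms.sum).mulVec v = 0 ↔ ∃ c : ℂ, v = c • histCat n) := by
  choose T hT1 hT2 hT3 hT4 using exists_term n
  let I : Finset (Fin n × (Fin n → Fin 3) × (Fin n → Fin 3) × Fin 3) :=
    Finset.univ.filter fun z => Con (win n z.1) z.2.1 z.2.2.1 (cc z.2.2.2) (histCat n)
  have hpsd : ∀ M ∈ I.toList.map (fun z => T z.1 z.2.1 z.2.2.1 (cc z.2.2.2)), M.PosSemidef := by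
    intro M hM
    obtain ⟨z, _, rfl⟩ := List.mem_map.1 hM
    exact hT1 _ _ _ _
  refine ⟨I.toList.map (fun z => T z.1 z.2.1 z.2.2.1 (cc z.2.2.2)), ?_, sum_psd _ hpsd, ?_⟩
  · intro M hM
    obtain ⟨z, _, rfl⟩ := List.mem_map.1 hM
    exact ⟨hT1 _ _ _ _, hT2 _ _ _ _, z.1, hT3 _ _ _ _⟩
  · intro v
    rw [sum_ker _ hpsd]
    constructor
    · intro h
      apply uniq
      intro a ha p q k hcon
      rw [← hT4]
      apply h
      exact List.mem_map.2 ⟨(⟨a, ha⟩, p, q, k), by simpa [I] using hcon, rfl⟩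
    · rintro ⟨c, rfl⟩ M hM
      obtain ⟨z, hz, rfl⟩ := List.mem_map.1 hM
      rw [hT4]
      have : Con (win n z.1) z.2.1 z.2.2.1 (cc z.2.2.2) (histCat n) := by simpa [I] using hz
      exact con_smul this c

end CatState
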